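/- Let d ≥ 2 be an integer and p ∈ ℝ, and let f : ℝ^{d-1} × ℝ → ℝ be smooth with compact support contained in ℝ^{d-1} × (0,∞). Then for every k ∈ ℝ^{d-1} and θ ∈ (0, π/2): (F R^(p) f)(k, θ) = cos(θ)^{p−1} · ∫_0^∞ (y·tan(θ))^{d-2} · y^{-p} · (F f)(k, y) · (∫_{S^{d-2}} e^{i·y·tan(θ)·⟨k,n⟩} dn) dy. (This is the Fourier slice identity with the Bessel-function kernel written as an explicit sphere integral.) -/

import Mathlib

open MeasureTheory Real Metric
open scoped RealInnerProductSpace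

noncomputable section

/-- The standard surface measure on the unit sphere `S^{d-2} ⊆ ℝ^{d-1}`
(for `d = 2` this is the counting measure on `S^0 = {±1}`). -/
def sphereMeasure (d : ℕ) : Measure (sphere (0 : EuclideanSpace ℝ (Fin (d - 1))) 1) :=
  (volume : Measure (EuclideanSpace ℝ (Fin (d - 1)))).toSphere

/-- The conical Radon transform with radial weight `1/s^p`:
`(R^(p) f)(u, θ) = ∫_0^∞ s^(-p) ∫_{S^{d-2}} f(u + s sin θ n, s cos θ) (s sin θ)^(d-2) dn ds`. -/
def coneRadon (d : ℕ) (p : ℝ) (f : EuclideanSpace ℝ (Fin (d - 1)) × ℝ → ℝ)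
    (u : EuclideanSpace ℝ (Fin (d - 1))) (θ : ℝ) : ℝ :=
  ∫ s in Set.Ioi (0 : ℝ),
    s ^ (-p) *
      ∫ n, f (u + (s * Real.sin θ) • (n : EuclideanSpace ℝ (Fin (d - 1))), s * Real.cos θ) *
          (s * Real.sin θ) ^ (d - 2) ∂(sphereMeasure d)

/-- Fourier transform in the first argument:
`(F g)(k, θ) = ∫_{ℝ^{d-1}} e^{-i⟨k,u⟩} g(u, θ) du`. -/
def fourierFirst (d : ℕ) (g : EuclideanSpace ℝ (Fin (d - 1)) → ℝ → ℝ)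
    (k : EuclideanSpace ℝ (Fin (d - 1))) (θ : ℝ) : ℂ :=
  ∫ u, Complex.exp (-Complex.I * (⟪k, u⟫ : ℝ)) * (g u θ : ℂ)

/-- The Riesz-filtered data
`g(u, θ) = (2π)^(1-d) ∫_{ℝ^{d-1}} |k|^(d-1) (F R^(p) f)(k, θ) e^{i⟨k,u⟩} dk`. -/
def filteredData (d : ℕ) (p : ℝ) (f : EuclideanSpace ℝ (Fin (d - 1)) × ℝ → ℝ)
    (u : EuclideanSpace ℝ (Fin (d - 1))) (θ : ℝ) : ℂ :=
  (((2 * π) ^ ((1 : ℤ) - (d : ℤ)) : ℝ) : ℂ) *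
    ∫ k, ((‖k‖ ^ (d - 1) : ℝ) : ℂ) * fourierFirst d (coneRadon d p f) k θ *
      Complex.exp (Complex.I * (⟪k, u⟫ : ℝ))

/-- If `f` is continuous with compact support in the open upper half-space, then so is its product
with a real power of the height. -/
theorem continuous_rpow_snd_mul {E : Type*} [TopologicalSpace E] {f : E × ℝ → ℝ}
    (hf : Continuous f) (hfs : tsupport f ⊆ {q : E × ℝ | 0 < q.2}) (r : ℝ) :
    Continuous fun q : E × ℝ => q.2 ^ r * f q := by
  rw [continuous_iff_continuousAt]
  intro q
  by_cases hq : q ∈ tsupport f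
  · exact (continuousAt_snd.rpow_const (Or.inl (hfs hq).ne')).mul hf.continuousAt
  · have h0 : (fun q : E × ℝ => q.2 ^ r * f q) =ᶠ[nhds q] fun _ => 0 := by
      filter_upwards [notMem_tsupport_iff_eventuallyEq.mp hq] with x hx
      simp [hx]
    exact continuousAt_const.congr h0.symm

theorem isFiniteMeasure_sphereMeasure (d : ℕ) : IsFiniteMeasure (sphereMeasure d) := by
  unfold sphereMeasure
  infer_instance

/-- The Fourier transform in the first argument turns a translation into a modulation. -/
theorem fourierFirst_translate (d : ℕ) (g : EuclideanSpace ℝ (Fin (d - 1)) → ℝ → ℝ)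
    (k v : EuclideanSpace ℝ (Fin (d - 1))) (y : ℝ) :
    fourierFirst d (fun u => g (u + v)) k y =
      Complex.exp (Complex.I * (⟪k, v⟫ : ℝ)) * fourierFirst d g k y := by
  unfold fourierFirst
  rw [← integral_const_mul, ← integral_add_right_eq_self (μ := volume)
    (fun u => Complex.exp (Complex.I * (⟪k, v⟫ : ℝ)) *
      (Complex.exp (-Complex.I * (⟪k, u⟫ : ℝ)) * (g u y : ℂ))) v]
  refine integral_congr_ae (.of_forall fun u => ?_)
  simp only
  rw [← mul_assoc, ← Complex.exp_add, inner_add_right]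
  congr 2
  push_cast
  ring

/-- Integration in the order `u, s, n` may be replaced by `s, n, u` for continuous compactly
supported functions. -/
theorem integral_rotate {E S : Type*} [TopologicalSpace E] [T2Space E] [MeasurableSpace E]
    [OpensMeasurableSpace E] [SecondCountableTopology E]
    [TopologicalSpace S] [T2Space S] [MeasurableSpace S] [OpensMeasurableSpace S] [SecondCountableTopology S]
    {μ : Measure E} {ν : Measure ℝ} {σ : Measure S} [SFinite μ] [SFinite ν] [SFinite σ]
    [IsFiniteMeasureOnCompacts μ] [IsFiniteMeasureOnCompacts ν] [IsFiniteMeasureOnCompacts σ]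
    {G : (E × ℝ) × S → ℂ} (hG : Continuous G) {K : Set ((E × ℝ) × S)} (hK : IsCompact K)
    (hGK : ∀ x, x ∉ K → G x = 0) :
    ∫ u, ∫ s, ∫ n, G ((u, s), n) ∂σ ∂ν ∂μ = ∫ s, ∫ n, ∫ u, G ((u, s), n) ∂μ ∂σ ∂ν := by
  have h : Integrable G ((μ.prod ν).prod σ) :=
    hG.integrable_of_hasCompactSupport (HasCompactSupport.intro hK hGK)
  rw [integral_integral_swap h.integral_prod_left]
  refine integral_congr_ae (.of_forall fun s => ?_)
  refine integral_integral_swap (f := fun u n => G ((u, s), n)) ?_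
  refine Continuous.integrable_of_hasCompactSupport (by fun_prop)
    (HasCompactSupport.intro (hK.image (f := fun x => (x.1.1, x.2)) (by fun_prop)) ?_)
  rintro ⟨u, n⟩ hx
  exact hGK _ fun hmem => hx ⟨_, hmem, rfl⟩

/-- Fourier slice identity with the Bessel kernel written as a sphere
integral: `(F R^(p) f)(k, θ)
= cos θ^{p-1} ∫_0^∞ (y tan θ)^{d-2} y^{-p} (F f)(k, y) (∫_{S^{d-2}} e^{i y tan θ ⟨k,n⟩} dn) dy`. -/
theorem fourier_coneRadon (d : ℕ) (hd : 2 ≤ d) (p : ℝ)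
    (f : EuclideanSpace ℝ (Fin (d - 1)) × ℝ → ℝ)
    (hf : ContDiff ℝ (⊤ : ℕ∞) f) (hfc : HasCompactSupport f)
    (hfs : tsupport f ⊆ {q : EuclideanSpace ℝ (Fin (d - 1)) × ℝ | 0 < q.2})
    (k : EuclideanSpace ℝ (Fin (d - 1))) (θ : ℝ) (hθ : θ ∈ Set.Ioo (0 : ℝ) (π / 2)) :
    fourierFirst d (coneRadon d p f) k θ =
      ((Real.cos θ ^ (p - 1) : ℝ) : ℂ) *
        ∫ y in Set.Ioi (0 : ℝ),
          (((y * Real.tan θ) ^ (d - 2) * y ^ (-p) : ℝ) : ℂ) *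
            fourierFirst d (fun u y => f (u, y)) k y *
            ∫ n, Complex.exp (Complex.I *
                ((y * Real.tan θ) * ⟪k, (n : EuclideanSpace ℝ (Fin (d - 1)))⟫ : ℝ))
              ∂(sphereMeasure d) := by
  have := isFiniteMeasure_sphereMeasure d
  have hcos : 0 < Real.cos θ := Real.cos_pos_of_mem_Ioo ⟨by linarith [hθ.1, Real.pi_pos], hθ.2⟩
  have htan : Real.cos θ * Real.tan θ = Real.sin θ := by
    rw [mul_comm, Real.tan_mul_cos hcos.ne']
  set h : EuclideanSpace ℝ (Fin (d - 1)) × ℝ → ℝ := fun q => q.2 ^ (-p) * f q with hh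
  have hcont : Continuous h := continuous_rpow_snd_mul hf.continuous hfs (-p)
  set G : (EuclideanSpace ℝ (Fin (d - 1)) × ℝ) ×
      sphere (0 : EuclideanSpace ℝ (Fin (d - 1))) 1 → ℂ := fun x =>
    Complex.exp (-Complex.I * (⟪k, x.1.1⟫ : ℝ)) *
      ((Real.cos θ ^ p * (h (x.1.1 + (x.1.2 * Real.sin θ) • (x.2 : EuclideanSpace ℝ (Fin (d - 1))),
        x.1.2 * Real.cos θ) * (x.1.2 * Real.sin θ) ^ (d - 2)) : ℝ) : ℂ) with hGdef
  have hGcont : Continuous G := by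
    rw [hGdef]
    fun_prop
  set Φ : (EuclideanSpace ℝ (Fin (d - 1)) × ℝ) × sphere (0 : EuclideanSpace ℝ (Fin (d - 1))) 1 →
      (EuclideanSpace ℝ (Fin (d - 1)) × ℝ) × sphere (0 : EuclideanSpace ℝ (Fin (d - 1))) 1 :=
    fun x => ((x.1.1 - (x.1.2 * Real.tan θ) • (x.2 : EuclideanSpace ℝ (Fin (d - 1))),
      x.1.2 / Real.cos θ), x.2) with hΦ
  have hK : IsCompact (Φ '' (tsupport f ×ˢ Set.univ)) :=
    (hfc.isCompact.prod isCompact_univ).image (by rw [hΦ]; fun_prop)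
  have hGK : ∀ x, x ∉ Φ '' (tsupport f ×ˢ Set.univ) → G x = 0 := by
    rintro ⟨⟨u, s⟩, n⟩ hx
    have h0 : f (u + (s * Real.sin θ) • (n : EuclideanSpace ℝ (Fin (d - 1))),
        s * Real.cos θ) = 0 := by
      by_contra hne
      refine hx ⟨((_, _), n), ⟨subset_tsupport f hne, Set.mem_univ _⟩, ?_⟩
      simp [hΦ, mul_assoc, htan, hcos.ne']
    simp [hGdef, hh, h0]
  have hpow : ∀ s : ℝ, 0 < s → Real.cos θ ^ p * (s * Real.cos θ) ^ (-p) = s ^ (-p) := by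
    intro s hs
    rw [Real.mul_rpow hs.le hcos.le, mul_left_comm, ← Real.rpow_add hcos]
    simp
  have hsub : ∀ s : ℝ, 0 < s → ∀ n : sphere (0 : EuclideanSpace ℝ (Fin (d - 1))) 1,
      ∫ u, G ((u, s), n) = ((s ^ (-p) * (s * Real.sin θ) ^ (d - 2) : ℝ) : ℂ) *
        fourierFirst d (fun u y => f (u, y)) k (s * Real.cos θ) *
        Complex.exp (Complex.I *
          ((s * Real.sin θ) * ⟪k, (n : EuclideanSpace ℝ (Fin (d - 1)))⟫ : ℝ)) := by
    intro s hs n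
    have ht := fourierFirst_translate d (fun u y => f (u, y)) k
      ((s * Real.sin θ) • (n : EuclideanSpace ℝ (Fin (d - 1)))) (s * Real.cos θ)
    rw [real_inner_smul_right] at ht
    rw [mul_assoc, mul_comm (fourierFirst d _ _ _), ← ht, fourierFirst, ← integral_const_mul]
    refine integral_congr_ae (.of_forall fun u => ?_)
    simp only [hGdef, hh]
    rw [← hpow s hs]
    push_cast
    ring
  set Ψ : ℝ → ℂ := fun y => (((y * Real.tan θ) ^ (d - 2) * y ^ (-p) : ℝ) : ℂ) *
    fourierFirst d (fun u y => f (u, y)) k y *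
    ∫ n, Complex.exp (Complex.I *
        ((y * Real.tan θ) * ⟪k, (n : EuclideanSpace ℝ (Fin (d - 1)))⟫ : ℝ))
      ∂(sphereMeasure d) with hΨ
  calc fourierFirst d (coneRadon d p f) k θ
      = ∫ u, ∫ s in Set.Ioi (0 : ℝ), ∫ n, G ((u, s), n) ∂(sphereMeasure d) := by
        unfold fourierFirst coneRadon
        refine integral_congr_ae (.of_forall fun u => ?_)
        simp only
        rw [← integral_complex_ofReal, ← integral_const_mul]
        refine setIntegral_congr_fun measurableSet_Ioi fun s hs => ?_
        rw [Complex.ofReal_mul, ← integral_complex_ofReal, ← integral_const_mul,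
          ← integral_const_mul]
        refine integral_congr_ae (.of_forall fun n => ?_)
        simp only [hGdef, hh]
        rw [← hpow s hs]
        push_cast
        ring
    _ = ∫ s in Set.Ioi (0 : ℝ), ∫ n, (∫ u, G ((u, s), n)) ∂(sphereMeasure d) :=
        integral_rotate hGcont hK hGK
    _ = ∫ s in Set.Ioi (0 : ℝ), ((Real.cos θ ^ p : ℝ) : ℂ) * Ψ (s * Real.cos θ) := by
        refine setIntegral_congr_fun measurableSet_Ioi fun s hs => ?_
        simp only [hsub s hs, hΨ]
        rw [integral_const_mul, mul_assoc s, htan, ← hpow s hs]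
        push_cast
        ring
    _ = _ := by
        rw [integral_const_mul, integral_comp_mul_right_Ioi Ψ 0 hcos, zero_mul, Complex.real_smul,
          ← mul_assoc, ← Complex.ofReal_mul, Real.rpow_sub_one hcos.ne', div_eq_mul_inv]
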